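/- Let u be a fuzzy number and K > 0. Then the following three statements are equivalent: (i) u is Lipschitz with constant K, i.e., |u(x) − u(y)| ≤ K|x − y| for all x, y ∈ [u]_0; (ii) |α − β| ≤ K|u⁻(α) − u⁻(β)| for all α, β ∈ [u(u⁻(0)), 1], and |γ − δ| ≤ K|u⁺(γ) − u⁺(δ)| for all γ, δ ∈ [u(u⁺(0)), 1]; (iii) |α − β| ≤ K|u_s⁻(α) − u⁻(β)| for all α, β ∈ [u(u⁻(0)), 1], and |γ − δ| ≤ K|u_s⁺(γ) − u⁺(δ)| for all γ, δ ∈ [u(u⁺(0)), 1]. -/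

import Mathlib

open Set Filter Topology

/-- A fuzzy number: a function `ℝ → ℝ` taking values in `[0,1]`, whose `α`-cuts
(for `α ∈ (0,1]`) and whose `0`-cut (the closure of the support) are nonempty
compact intervals. -/
structure FuzzyNumber where
  f : ℝ → ℝ
  mem_Icc : ∀ x, f x ∈ Set.Icc (0 : ℝ) 1
  cut_isIcc : ∀ α ∈ Set.Ioc (0 : ℝ) 1, ∃ a b : ℝ, a ≤ b ∧ {x | α ≤ f x} = Set.Icc a b
  supp_isIcc : ∃ a b : ℝ, a ≤ b ∧ closure {x | 0 < f x} = Set.Icc a b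

namespace FuzzyNumber

/-- The `α`-cut of a fuzzy number; for `α = 0` it is the closure of the support. -/
noncomputable def cut (u : FuzzyNumber) (α : ℝ) : Set ℝ :=
  if α = 0 then closure {x | 0 < u.f x} else {x | α ≤ u.f x}

/-- Left endpoint `u⁻(α)` of the `α`-cut. -/
noncomputable def lo (u : FuzzyNumber) (α : ℝ) : ℝ := sInf (u.cut α)

/-- Right endpoint `u⁺(α)` of the `α`-cut. -/
noncomputable def hi (u : FuzzyNumber) (α : ℝ) : ℝ := sSup (u.cut α)

/-- Left endpoint `u_s⁻(α)` of the strong `α`-cut: `lim_{β→α⁺} u⁻(β)` for `α < 1`,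
and `u⁻(1)` for `α = 1`.  Since `u⁻` is nondecreasing, this right limit is the
infimum of `u⁻` over `(α,1]`. -/
noncomputable def slo (u : FuzzyNumber) (α : ℝ) : ℝ :=
  if α < 1 then sInf (u.lo '' Set.Ioc α 1) else u.lo 1

/-- Right endpoint `u_s⁺(α)` of the strong `α`-cut: `lim_{β→α⁺} u⁺(β)` for `α < 1`,
and `u⁺(1)` for `α = 1`. -/
noncomputable def shi (u : FuzzyNumber) (α : ℝ) : ℝ :=
  if α < 1 then sSup (u.hi '' Set.Ioc α 1) else u.hi 1

/-- The sup-min convolution `u∇v` of two fuzzy numbers, as a function on `ℝ`: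
`(u∇v)(x) = sup_y min (u y) (v (x - y))`.  Its cut functions satisfy
`(u∇v)⁻(α) = u⁻(α) + v⁻(α)` and `(u∇v)⁺(α) = u⁺(α) + v⁺(α)`. -/
noncomputable def conv (u v : FuzzyNumber) (x : ℝ) : ℝ :=
  ⨆ y : ℝ, min (u.f y) (v.f (x - y))

end FuzzyNumber

/-- `f` has left derivative `f'` at `x`. -/
def HasLeftDerivAt (f : ℝ → ℝ) (f' x : ℝ) : Prop :=
  HasDerivWithinAt f f' (Set.Iio x) x

/-- `f` has right derivative `f'` at `x`. -/
def HasRightDerivAt (f : ℝ → ℝ) (f' x : ℝ) : Prop :=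
  HasDerivWithinAt f f' (Set.Ioi x) x

namespace FuzzyNumber

variable (u : FuzzyNumber)

theorem exists_cut_eq_Icc {α : ℝ} (hα : α ∈ Icc (0 : ℝ) 1) :
    ∃ a b : ℝ, a ≤ b ∧ u.cut α = Icc a b := by
  unfold cut
  split_ifs with h
  · exact u.supp_isIcc
  · exact u.cut_isIcc α ⟨lt_of_le_of_ne hα.1 (Ne.symm h), hα.2⟩

theorem cut_eq_Icc {α : ℝ} (hα : α ∈ Icc (0 : ℝ) 1) :
    u.cut α = Icc (u.lo α) (u.hi α) := by
  obtain ⟨a, b, hab, h⟩ := u.exists_cut_eq_Icc hα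
  rw [lo, hi, h, csInf_Icc hab, csSup_Icc hab]

theorem lo_le_hi {α : ℝ} (hα : α ∈ Icc (0 : ℝ) 1) : u.lo α ≤ u.hi α := by
  obtain ⟨a, b, hab, h⟩ := u.exists_cut_eq_Icc hα
  rwa [lo, hi, h, csInf_Icc hab, csSup_Icc hab]

theorem mem_cut {α x : ℝ} (hα : 0 < α) : x ∈ u.cut α ↔ α ≤ u.f x := by
  simp [cut, hα.ne']

theorem cut_subset {α β : ℝ} (hα : 0 ≤ α) (h : α ≤ β) : u.cut β ⊆ u.cut α := by
  rcases hα.eq_or_lt with rfl | hα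
  · rcases h.eq_or_lt with rfl | h
    · rfl
    · intro x hx
      rw [u.mem_cut h] at hx
      rw [cut, if_pos rfl]
      exact subset_closure (h.trans_le hx)
  · intro x hx
    rw [u.mem_cut (hα.trans_le h)] at hx
    exact (u.mem_cut hα).2 (h.trans hx)

theorem lo_mem_cut {α : ℝ} (hα : α ∈ Icc (0 : ℝ) 1) : u.lo α ∈ u.cut α := by
  rw [u.cut_eq_Icc hα]
  exact left_mem_Icc.2 (u.lo_le_hi hα)

theorem lo_le_of_mem_cut {α x : ℝ} (hα : α ∈ Icc (0 : ℝ) 1) (hx : x ∈ u.cut α) :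
    u.lo α ≤ x := by
  rw [u.cut_eq_Icc hα] at hx
  exact hx.1

theorem lo_mono {α β : ℝ} (hα : 0 ≤ α) (h : α ≤ β) (hβ : β ≤ 1) : u.lo α ≤ u.lo β :=
  u.lo_le_of_mem_cut ⟨hα, h.trans hβ⟩
    (u.cut_subset hα h (u.lo_mem_cut ⟨hα.trans h, hβ⟩))

theorem lo_mem_Icc {α : ℝ} (hα : α ∈ Icc (0 : ℝ) 1) : u.lo α ∈ Icc (u.lo 0) (u.hi 0) := by
  rw [← u.cut_eq_Icc (by simp)]
  exact u.cut_subset le_rfl hα.1 (u.lo_mem_cut hα)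

theorem le_f_lo {α : ℝ} (hα : α ∈ Icc (0 : ℝ) 1) : α ≤ u.f (u.lo α) := by
  rcases hα.1.eq_or_lt with rfl | h
  · exact (u.mem_Icc _).1
  · exact (u.mem_cut h).1 (u.lo_mem_cut hα)

/-- A point to the left of a point of an `α`-cut, but outside that cut, lies below `u⁻(α)`. -/
theorem lt_lo_of_lt {α x y : ℝ} (hxy : x ≤ y) (hx : u.f x < α) (hy : α ≤ u.f y) :
    x < u.lo α := by
  have h0 : 0 < α := (u.mem_Icc x).1.trans_lt hx
  have hα : α ∈ Icc (0 : ℝ) 1 := ⟨h0.le, hy.trans (u.mem_Icc y).2⟩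
  have hy' := (u.mem_cut h0).2 hy
  have hx' := mt (u.mem_cut h0).1 hx.not_ge
  rw [u.cut_eq_Icc hα] at hx' hy'
  by_contra! h
  exact hx' ⟨h, hxy.trans hy'.2⟩

theorem min_le_f {x y z : ℝ} (hxz : x ≤ z) (hzy : z ≤ y) : min (u.f x) (u.f y) ≤ u.f z := by
  by_contra! h
  have hz := u.lt_lo_of_lt hzy h (min_le_right _ _)
  have h0 := (u.mem_Icc z).1.trans_lt h
  have := u.lo_le_of_mem_cut ⟨h0.le, (min_le_left _ _).trans (u.mem_Icc x).2⟩
    ((u.mem_cut h0).2 (min_le_left _ _))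
  linarith

theorem lo_le_slo {α : ℝ} (hα : α ∈ Icc (0 : ℝ) 1) : u.lo α ≤ u.slo α := by
  unfold slo
  split_ifs with h
  · refine le_csInf ((nonempty_Ioc.2 h).image _) ?_
    rintro _ ⟨β, hβ, rfl⟩
    exact u.lo_mono hα.1 hβ.1.le hβ.2
  · exact u.lo_mono hα.1 hα.2 le_rfl

theorem slo_le_lo {α β : ℝ} (hα : 0 ≤ α) (h : α < β) (hβ : β ≤ 1) : u.slo α ≤ u.lo β := by
  rw [slo, if_pos (h.trans_le hβ)]
  refine csInf_le ⟨u.lo α, ?_⟩ ⟨β, ⟨h, hβ⟩, rfl⟩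
  rintro _ ⟨γ, hγ, rfl⟩
  exact u.lo_mono hα hγ.1.le hγ.2

/-- The inverse-Lipschitz condition for `u⁻` holds if and only if `u` grows with slope
at most `K` on its `0`-cut. -/
theorem lo_condition_iff_slope_le {K : ℝ} (hK : 0 < K) :
    (∀ α ∈ Icc (u.f (u.lo 0)) 1, ∀ β ∈ Icc (u.f (u.lo 0)) 1,
      |α - β| ≤ K * |u.lo α - u.lo β|) ↔
    ∀ x ∈ Icc (u.lo 0) (u.hi 0), ∀ y ∈ Icc (u.lo 0) (u.hi 0), x ≤ y →
      u.f y - u.f x ≤ K * (y - x) := by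
  have h0 := (u.mem_Icc (u.lo 0)).1
  constructor
  · intro H x hx y hy hxy
    rcases le_or_gt (u.f y) (u.f x) with h | h
    · nlinarith
    have hx0 : u.f (u.lo 0) ≤ u.f x := by
      rcases min_le_iff.1 (u.min_le_f hx.1 hxy) with h' | h'
      · exact h'
      · exact absurd h' h.not_ge
    have hy1 := (u.mem_Icc y).2
    have key : ∀ α, u.f x < α → α < u.f y → u.f y - K * (y - x) ≤ α := by
      intro α h1 h2
      have hxα := u.lt_lo_of_lt hxy h1 h2.le
      have hyβ : u.lo (u.f y) ≤ y := u.lo_le_of_mem_cut (u.mem_Icc y)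
        ((u.mem_cut (by linarith)).2 le_rfl)
      have hm := u.lo_mono (by linarith) h2.le hy1
      have := H (u.f y) ⟨by linarith, hy1⟩ α ⟨by linarith, by linarith⟩
      rw [abs_of_pos (by linarith), abs_of_nonneg (by linarith)] at this
      nlinarith
    suffices u.f y - K * (y - x) ≤ u.f x by linarith
    refine le_of_forall_gt_imp_ge_of_dense fun α hα => ?_
    rcases lt_or_ge α (u.f y) with h' | h'
    · exact key α hα h'
    · nlinarith
  · intro H
    have fle : ∀ α ∈ Icc (u.f (u.lo 0)) 1, u.f (u.lo α) ≤ α := by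
      intro α hα
      have hα' : α ∈ Icc (0 : ℝ) 1 := ⟨h0.trans hα.1, hα.2⟩
      have hmem := u.lo_mem_Icc hα'
      rcases hmem.1.eq_or_lt with h | h
      · rw [← h]
        exact hα.1
      have hα0 : 0 < α := hα'.1.lt_of_ne (by rintro rfl; exact h.false)
      refine le_of_forall_pos_le_add fun ε hε => ?_
      obtain ⟨x, hx1, hx2⟩ := exists_between (max_lt h (sub_lt_self (u.lo α) (div_pos hε hK)))
      rw [max_lt_iff] at hx1
      have hfx : u.f x < α := by
        by_contra! h'
        exact hx2.not_ge (u.lo_le_of_mem_cut hα' ((u.mem_cut hα0).2 h'))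
      have hs := H x ⟨hx1.1.le, hx2.le.trans hmem.2⟩ _ hmem hx2.le
      have : K * (u.lo α - x) ≤ ε := by
        rw [mul_comm, ← le_div_iff₀ hK]
        linarith [hx1.2]
      linarith
    have key : ∀ α ∈ Icc (u.f (u.lo 0)) 1, ∀ β ∈ Icc (u.f (u.lo 0)) 1, α ≤ β →
        |α - β| ≤ K * |u.lo α - u.lo β| := by
      intro α hα β hβ h
      have hα' : α ∈ Icc (0 : ℝ) 1 := ⟨h0.trans hα.1, hα.2⟩
      have hβ' : β ∈ Icc (0 : ℝ) 1 := ⟨h0.trans hβ.1, hβ.2⟩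
      have hm := u.lo_mono hα'.1 h hβ.2
      rw [abs_sub_comm, abs_of_nonneg (by linarith), abs_sub_comm (u.lo α),
        abs_of_nonneg (by linarith)]
      linarith [H _ (u.lo_mem_Icc hα') _ (u.lo_mem_Icc hβ') hm, fle α hα, u.le_f_lo hβ']
    intro α hα β hβ
    rcases le_total α β with h | h
    · exact key α hα β hβ h
    · rw [abs_sub_comm, abs_sub_comm (u.lo α)]
      exact key β hβ α hα h

theorem lo_condition_iff_slo_condition {K : ℝ} (hK : 0 < K) :
    (∀ α ∈ Icc (u.f (u.lo 0)) 1, ∀ β ∈ Icc (u.f (u.lo 0)) 1,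
      |α - β| ≤ K * |u.lo α - u.lo β|) ↔
    ∀ α ∈ Icc (u.f (u.lo 0)) 1, ∀ β ∈ Icc (u.f (u.lo 0)) 1,
      |α - β| ≤ K * |u.slo α - u.lo β| := by
  have h0 := (u.mem_Icc (u.lo 0)).1
  constructor
  · intro H α hα β hβ
    rcases le_or_gt β α with h | h
    · refine (H α hα β hβ).trans ?_
      have h1 := u.lo_mono (h0.trans hβ.1) h hα.2
      have h2 := u.lo_le_slo ⟨h0.trans hα.1, hα.2⟩
      rw [abs_of_nonneg (by linarith), abs_of_nonneg (by linarith)]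
      gcongr
    · have h1 := u.slo_le_lo (h0.trans hα.1) h hβ.2
      rw [abs_sub_comm, abs_of_pos (by linarith), abs_sub_comm (u.slo α),
        abs_of_nonneg (by linarith)]
      suffices β - K * (u.lo β - u.slo α) ≤ α by linarith
      refine le_of_forall_gt_imp_ge_of_dense fun γ hγ => ?_
      rcases le_or_gt β γ with h' | h'
      · nlinarith
      have h2 := u.slo_le_lo (h0.trans hα.1) hγ (h'.le.trans hβ.2)
      have h3 := u.lo_mono (by linarith [hα.1]) h'.le hβ.2
      have := H β hβ γ ⟨hα.1.trans hγ.le, h'.le.trans hβ.2⟩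
      rw [abs_of_pos (by linarith), abs_of_nonneg (by linarith)] at this
      nlinarith
  · intro H
    have key : ∀ α ∈ Icc (u.f (u.lo 0)) 1, ∀ β ∈ Icc (u.f (u.lo 0)) 1, α < β →
        |α - β| ≤ K * |u.lo α - u.lo β| := by
      intro α hα β hβ h
      refine (H α hα β hβ).trans ?_
      have h1 := u.slo_le_lo (h0.trans hα.1) h hβ.2
      have h2 := u.lo_le_slo ⟨h0.trans hα.1, hα.2⟩
      rw [abs_sub_comm, abs_of_nonneg (by linarith), abs_sub_comm (u.lo α),
        abs_of_nonneg (by linarith)]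
      gcongr
    intro α hα β hβ
    rcases lt_trichotomy α β with h | rfl | h
    · exact key α hα β hβ h
    · simp
    · rw [abs_sub_comm, abs_sub_comm (u.lo α)]
      exact key β hβ α hα h

/-- The reflection `x ↦ u(-x)` of a fuzzy number. -/
def reflect : FuzzyNumber where
  f x := u.f (-x)
  mem_Icc x := u.mem_Icc (-x)
  cut_isIcc α hα := by
    obtain ⟨a, b, hab, h⟩ := u.cut_isIcc α hα
    refine ⟨-b, -a, neg_le_neg hab, ?_⟩
    rw [← Set.neg_Icc, ← h]
    rfl
  supp_isIcc := by
    obtain ⟨a, b, hab, h⟩ := u.supp_isIcc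
    refine ⟨-b, -a, neg_le_neg hab, ?_⟩
    rw [← Set.neg_Icc, ← h]
    exact ((Homeomorph.neg ℝ).preimage_closure {x | 0 < u.f x}).symm

theorem reflect_f (x : ℝ) : u.reflect.f x = u.f (-x) := rfl

open scoped Pointwise in
theorem reflect_cut (α : ℝ) : u.reflect.cut α = -u.cut α := by
  unfold cut
  split_ifs
  · exact ((Homeomorph.neg ℝ).preimage_closure {x | 0 < u.f x}).symm
  · rfl

theorem reflect_lo (α : ℝ) : u.reflect.lo α = -u.hi α := by
  rw [lo, reflect_cut, Real.sInf_neg, hi]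

theorem reflect_hi (α : ℝ) : u.reflect.hi α = -u.lo α := by
  rw [hi, reflect_cut, Real.sSup_neg, lo]

theorem reflect_slo (α : ℝ) : u.reflect.slo α = -u.shi α := by
  unfold slo shi
  split_ifs
  · rw [← Real.sInf_neg, ← Set.image_neg_eq_neg, Set.image_image]
    simp only [reflect_lo]
  · exact u.reflect_lo 1

theorem abs_sub_le_iff_slope_le {K : ℝ} :
    (∀ x ∈ Icc (u.lo 0) (u.hi 0), ∀ y ∈ Icc (u.lo 0) (u.hi 0),
      |u.f x - u.f y| ≤ K * |x - y|) ↔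
    (∀ x ∈ Icc (u.lo 0) (u.hi 0), ∀ y ∈ Icc (u.lo 0) (u.hi 0), x ≤ y →
      u.f y - u.f x ≤ K * (y - x)) ∧
    ∀ x ∈ Icc (u.reflect.lo 0) (u.reflect.hi 0), ∀ y ∈ Icc (u.reflect.lo 0) (u.reflect.hi 0),
      x ≤ y → u.reflect.f y - u.reflect.f x ≤ K * (y - x) := by
  simp only [reflect_lo, reflect_hi, reflect_f]
  constructor
  · intro H
    refine ⟨fun x hx y hy h => ?_, fun x hx y hy h => ?_⟩
    · have := H y hy x hx
      rw [abs_of_nonneg (sub_nonneg.2 h)] at this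
      exact (le_abs_self _).trans this
    · have := H (-y) ⟨by linarith [hy.2], by linarith [hy.1]⟩
        (-x) ⟨by linarith [hx.2], by linarith [hx.1]⟩
      rw [neg_sub_neg, abs_sub_comm x, abs_of_nonneg (sub_nonneg.2 h)] at this
      exact (le_abs_self _).trans this
  · rintro ⟨H₁, H₂⟩
    have key : ∀ x ∈ Icc (u.lo 0) (u.hi 0), ∀ y ∈ Icc (u.lo 0) (u.hi 0), x ≤ y →
        |u.f x - u.f y| ≤ K * |x - y| := by
      intro x hx y hy h
      rw [abs_sub_comm x, abs_of_nonneg (sub_nonneg.2 h), abs_sub_le_iff]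
      refine ⟨?_, H₁ x hx y hy h⟩
      have := H₂ (-y) ⟨neg_le_neg hy.2, neg_le_neg hy.1⟩
        (-x) ⟨neg_le_neg hx.2, neg_le_neg hx.1⟩ (neg_le_neg h)
      rwa [neg_neg, neg_neg, neg_sub_neg] at this
    intro x hx y hy
    rcases le_total x y with h | h
    · exact key x hx y hy h
    · rw [abs_sub_comm, abs_sub_comm x]
      exact key y hy x hx h

end FuzzyNumber

/-- Lemma `glec`: for a fuzzy number `u` and `K > 0`, the
following are equivalent: (i) `u` is Lipschitz with constant `K` on `[u]_0`;
(ii) the inverse-Lipschitz conditions for `u⁻` on `[u(u⁻(0)),1]` and for `u⁺`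
on `[u(u⁺(0)),1]`; (iii) the analogous conditions with `u_s⁻` and `u_s⁺`. -/
theorem lipschitz_tfae (u : FuzzyNumber) (K : ℝ) (hK : 0 < K) :
    List.TFAE [
      ∀ x ∈ Set.Icc (u.lo 0) (u.hi 0), ∀ y ∈ Set.Icc (u.lo 0) (u.hi 0),
        |u.f x - u.f y| ≤ K * |x - y|,
      (∀ α ∈ Set.Icc (u.f (u.lo 0)) 1, ∀ β ∈ Set.Icc (u.f (u.lo 0)) 1,
        |α - β| ≤ K * |u.lo α - u.lo β|) ∧
      (∀ γ ∈ Set.Icc (u.f (u.hi 0)) 1, ∀ δ ∈ Set.Icc (u.f (u.hi 0)) 1,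
        |γ - δ| ≤ K * |u.hi γ - u.hi δ|),
      (∀ α ∈ Set.Icc (u.f (u.lo 0)) 1, ∀ β ∈ Set.Icc (u.f (u.lo 0)) 1,
        |α - β| ≤ K * |u.slo α - u.lo β|) ∧
      (∀ γ ∈ Set.Icc (u.f (u.hi 0)) 1, ∀ δ ∈ Set.Icc (u.f (u.hi 0)) 1,
        |γ - δ| ≤ K * |u.shi γ - u.hi δ|)] := by
  have hlo := u.lo_condition_iff_slope_le hK
  have hslo := u.lo_condition_iff_slo_condition hK
  have hhi := u.reflect.lo_condition_iff_slope_le hK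
  have hshi := u.reflect.lo_condition_iff_slo_condition hK
  have hneg : ∀ a b : ℝ, |(-a) - (-b)| = |a - b| := fun a b => by
    rw [neg_sub_neg, abs_sub_comm]
  tfae_have 1 ↔ 2 := by
    rw [u.abs_sub_le_iff_slope_le, ← hlo, ← hhi]
    simp only [FuzzyNumber.reflect_lo, FuzzyNumber.reflect_f, neg_neg, hneg]
  tfae_have 2 ↔ 3 := by
    simp only [FuzzyNumber.reflect_lo, FuzzyNumber.reflect_slo, FuzzyNumber.reflect_f,
      neg_neg, hneg] at hshi
    rw [hslo, hshi]
  tfae_finish
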